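/- Let n be a natural number and C : ℝ → Matrix (Fin n) (Fin n) ℂ be continuous and entrywise integrable, and suppose C is a matrix-valued positive-definite function: for every m, every t : Fin m → ℝ, and every family of vectors v : Fin m → (Fin n → ℂ), the sum ∑_{i,j} (v i)† · C(t j − t i) · (v j) is a nonnegative real number (where w† M u denotes ∑_{a,b} conj(w a) M a b (u b)). Then for every ω ∈ ℝ, the matrix 𝒮(ω) = ∫_{-∞}^{∞} e^{iωt} C(t) dt (defined entrywise) is positive semidefinite. -/

import Mathlib

open MeasureTheory Matrix Complex
open scoped ComplexOrder

open ProbabilityTheory Filter Topology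
open scoped NNReal

lemma MeasureTheory.Integrable.gaussianReal {E : Type*} [NormedAddCommGroup E] [NormedSpace ℝ E]
    {g : ℝ → E} (hg : Integrable g) (m : ℝ) {v : ℝ≥0} (hv : v ≠ 0) :
    Integrable g (ProbabilityTheory.gaussianReal m v) := by
  rw [gaussianReal_of_var_ne_zero m hv, integrable_withDensity_iff_integrable_smul'
    (measurable_gaussianPDF m v) (ae_of_all _ fun _ ↦ gaussianPDF_lt_top)]
  simp only [toReal_gaussianPDF]
  refine hg.bdd_smul (√(2 * Real.pi * v))⁻¹
    (stronglyMeasurable_gaussianPDFReal m v).aestronglyMeasurable (ae_of_all _ fun x ↦ ?_)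
  rw [Real.norm_of_nonneg (gaussianPDFReal_nonneg m v x), gaussianPDFReal]
  refine mul_le_of_le_one_right (by positivity) (Real.exp_le_one_iff.2 ?_)
  rw [neg_div]
  exact neg_nonpos.2 (by positivity)

/-- The difference of two distinct coordinates of an i.i.d. centred Gaussian family. -/
lemma map_eval_sub_eval_pi_gaussianReal {ι : Type*} [Fintype ι] {i j : ι} (hij : i ≠ j) (v : ℝ≥0) :
    (Measure.pi fun _ : ι ↦ gaussianReal 0 v).map (fun x ↦ x j - x i) =
      gaussianReal 0 (v + v) := by
  set P := Measure.pi fun _ : ι ↦ gaussianReal 0 v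
  have hmap (k : ι) : P.map (fun x ↦ x k) = gaussianReal 0 v :=
    (measurePreserving_eval (fun _ : ι ↦ gaussianReal 0 v) k).map_eq
  have hind : IndepFun (fun x : ι → ℝ ↦ x j) (fun x : ι → ℝ ↦ x i) P :=
    (iIndepFun_pi (μ := fun _ : ι ↦ gaussianReal 0 v) (X := fun _ ↦ id)
      fun _ ↦ aemeasurable_id).indepFun hij.symm
  have hneg : P.map (fun x ↦ -x i) = gaussianReal 0 v := by
    have h := Measure.map_map (μ := P) measurable_neg (measurable_pi_apply i)
    rw [hmap] at h
    exact h.symm.trans (by simpa using gaussianReal_map_neg (μ := 0) (v := v))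
  have := gaussianReal_add_gaussianReal_of_indepFun
    (hind.comp measurable_id measurable_neg) (hmap j) hneg
  rw [add_zero] at this
  rw [← this]
  congr 1

/-- Averaging the positivity of `∑ i, ∑ j, g (t j - t i)` over i.i.d. Gaussian times `t i`. -/
lemma integral_gaussianReal_nonneg_of_sum_sub_nonneg {g : ℝ → ℂ} (hg : Integrable g)
    (hpos : ∀ (m : ℕ) (t : Fin m → ℝ), 0 ≤ ∑ i, ∑ j, g (t j - t i)) {v : ℝ≥0} (hv : v ≠ 0) :
    0 ≤ ∫ u, g u ∂(gaussianReal 0 (v + v)) := by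
  set I := ∫ u, g u ∂(gaussianReal 0 (v + v))
  have hgI : Integrable g (gaussianReal 0 (v + v)) := hg.gaussianReal 0 (by simpa using hv)
  have hsum (m : ℕ) : 0 ≤ (m : ℂ) * g 0 + m * (m - 1) * I := by
    set P := Measure.pi fun _ : Fin m ↦ gaussianReal 0 v
    have hmeas (i j : Fin m) : Measurable fun x : Fin m → ℝ ↦ x j - x i := by fun_prop
    have hint (i j : Fin m) : Integrable (fun x : Fin m → ℝ ↦ g (x j - x i)) P := by
      rcases eq_or_ne i j with rfl | hij
      · simp
      · rw [← map_eval_sub_eval_pi_gaussianReal hij v] at hgI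
        exact hgI.comp_measurable (hmeas i j)
    have hval (i j : Fin m) :
        ∫ x, g (x j - x i) ∂P = I + if i = j then g 0 - I else 0 := by
      rcases eq_or_ne i j with rfl | hij
      · simp
      · have hmap := map_eval_sub_eval_pi_gaussianReal hij v
        rw [if_neg hij, add_zero, ← integral_map (hmeas i j).aemeasurable, hmap]
        rw [hmap]
        exact hgI.aestronglyMeasurable
    have h : 0 ≤ ∫ x : Fin m → ℝ, ∑ i, ∑ j, g (x j - x i) ∂P := integral_nonneg fun x ↦ hpos m x
    rw [integral_finsetSum _ fun i _ ↦ integrable_finsetSum _ fun j _ ↦ hint i j] at h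
    simp_rw [integral_finsetSum _ fun j _ ↦ hint _ j, hval, Finset.sum_add_distrib] at h
    simp only [Finset.sum_const, Finset.card_univ, Fintype.card_fin, nsmul_eq_mul,
      Finset.sum_ite_eq, Finset.mem_univ, if_true] at h
    convert! h using 1
    ring
  have hlim : Tendsto (fun k : ℕ ↦ (1 / ((k : ℂ) + 1)) * g 0 + (1 - 1 / ((k : ℂ) + 1)) * I)
      atTop (𝓝 (0 * g 0 + (1 - 0) * I)) := by
    have h0 := tendsto_one_div_add_atTop_nhds_zero_nat (𝕜 := ℂ)
    exact (h0.mul_const _).add ((h0.const_sub 1).mul_const _)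
  rw [zero_mul, zero_add, sub_zero, one_mul] at hlim
  refine ge_of_tendsto' hlim fun k ↦ ?_
  have hk : (k : ℂ) + 1 ≠ 0 := by exact_mod_cast k.succ_ne_zero
  have hc : (0 : ℂ) ≤ ((((k : ℝ) + 1) ^ 2)⁻¹ : ℝ) := by
    exact_mod_cast (by positivity : (0 : ℝ) ≤ (((k : ℝ) + 1) ^ 2)⁻¹)
  convert! mul_nonneg hc (hsum (k + 1)) using 1
  push_cast
  field_simp

lemma tendsto_integral_exp_neg_sq_div_smul {E : Type*} [NormedAddCommGroup E] [NormedSpace ℝ E]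
    {g : ℝ → E} (hg : Integrable g) :
    Tendsto (fun v : ℝ ↦ ∫ u, Real.exp (-u ^ 2 / (2 * v)) • g u) atTop (𝓝 (∫ u, g u)) := by
  refine tendsto_integral_filter_of_dominated_convergence (fun u ↦ ‖g u‖) ?_ ?_ hg.norm ?_
  · refine Eventually.of_forall fun v ↦ ?_
    have h : Continuous fun u : ℝ ↦ Real.exp (-u ^ 2 / (2 * v)) := by fun_prop
    exact h.aestronglyMeasurable.smul hg.aestronglyMeasurable
  · filter_upwards [eventually_ge_atTop 0] with v hv
    refine ae_of_all _ fun u ↦ ?_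
    rw [norm_smul, Real.norm_of_nonneg (Real.exp_pos _).le]
    refine mul_le_of_le_one_left (norm_nonneg _) (Real.exp_le_one_iff.2 ?_)
    rw [neg_div]
    exact neg_nonpos.2 (by positivity)
  · refine ae_of_all _ fun u ↦ ?_
    have h : Tendsto (fun v : ℝ ↦ -u ^ 2 / (2 * v)) atTop (𝓝 0) :=
      (tendsto_id.const_mul_atTop two_pos).const_div_atTop _
    simpa using ((Real.continuous_exp.tendsto 0).comp h).smul_const (g u)

/-- An integrable function on `ℝ` with `∑ i, ∑ j, g (t j - t i) ≥ 0` for all finite families of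
times has nonnegative integral. -/
lemma integral_nonneg_of_sum_sub_nonneg {g : ℝ → ℂ} (hg : Integrable g)
    (hpos : ∀ (m : ℕ) (t : Fin m → ℝ), 0 ≤ ∑ i, ∑ j, g (t j - t i)) : 0 ≤ ∫ u, g u := by
  refine ge_of_tendsto (tendsto_integral_exp_neg_sq_div_smul hg) ?_
  filter_upwards [eventually_gt_atTop 0] with v hv
  lift v to ℝ≥0 using hv.le
  have hv0 : v ≠ 0 := by exact_mod_cast hv.ne'
  have h := integral_gaussianReal_nonneg_of_sum_sub_nonneg hg hpos (v := v / 2) (by simpa using hv0)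
  rw [add_halves, integral_gaussianReal_eq_integral_smul hv0] at h
  simp only [gaussianPDFReal, sub_zero, mul_smul, integral_smul] at h
  have hc : 0 < (√(2 * Real.pi * v))⁻¹ := by positivity
  exact (smul_nonneg_iff_nonneg_of_pos_left hc).1 h

lemma Matrix.PosSemidef.of_forall_dotProduct_mulVec_nonneg {ι : Type*} [Fintype ι]
    {M : Matrix ι ι ℂ} (hM : ∀ x, 0 ≤ star x ⬝ᵥ (M *ᵥ x)) : M.PosSemidef := by
  classical
  rw [← Matrix.isPositive_toEuclideanLin_iff, LinearMap.isPositive_iff_complex]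
  intro x
  have hin : inner ℂ (M.toEuclideanLin x) x = star (star x.ofLp ⬝ᵥ (M *ᵥ x.ofLp)) := by
    rw [EuclideanSpace.inner_eq_star_dotProduct, Matrix.star_dotProduct, dotProduct_comm]
    simp
  have h : 0 ≤ inner ℂ (M.toEuclideanLin x) x := hin ▸ star_nonneg_iff.2 (hM x.ofLp)
  obtain ⟨hre, him⟩ := Complex.nonneg_iff.1 h
  exact ⟨Complex.ext (by simp) (by simpa using him), hre⟩

/-- Matrix-valued Bochner-type positivity: the spectral density matrix
`𝒮(ω) = ∫ e^{iωt} C(t) dt` of a continuous, entrywise integrable, matrix-valued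
positive-definite function `C` is positive semidefinite at every frequency. -/
theorem spectral_density_matrix_posSemidef
    (n : ℕ) (C : ℝ → Matrix (Fin n) (Fin n) ℂ)
    (hcont : Continuous C)
    (hint : ∀ a b : Fin n, Integrable (fun t : ℝ => C t a b))
    (hposdef : ∀ (m : ℕ) (t : Fin m → ℝ) (v : Fin m → (Fin n → ℂ)),
      ∃ r : ℝ, 0 ≤ r ∧
        (∑ i, ∑ j, ∑ a, ∑ b, (starRingEnd ℂ (v i a)) * C (t j - t i) a b * (v j b))
          = (r : ℂ)) :
    ∀ ω : ℝ,
      (Matrix.of fun a b : Fin n =>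
        ∫ t : ℝ, Complex.exp (Complex.I * (ω : ℂ) * (t : ℂ)) * C t a b).PosSemidef := by
  intro ω
  refine .of_forall_dotProduct_mulVec_nonneg fun x ↦ ?_
  have hexp (a b : Fin n) :
      Integrable fun t : ℝ ↦ Complex.exp (Complex.I * (ω : ℂ) * (t : ℂ)) * C t a b := by
    refine (hint a b).bdd_mul (c := 1) (by fun_prop) (ae_of_all _ fun t ↦ ?_)
    rw [mul_assoc, mul_comm, ← Complex.ofReal_mul, Complex.norm_exp_ofReal_mul_I]
  have hterm (a b : Fin n) : Integrable fun t : ℝ ↦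
      star (x a) * ((Complex.exp (Complex.I * (ω : ℂ) * (t : ℂ)) * C t a b) * x b) :=
    ((hexp a b).mul_const _).const_mul _
  have key := integral_nonneg_of_sum_sub_nonneg (integrable_finsetSum Finset.univ fun a _ ↦
    integrable_finsetSum Finset.univ fun b _ ↦ hterm a b) fun m t ↦ ?_
  · rw [integral_finsetSum _ fun a _ ↦ integrable_finsetSum _ fun b _ ↦ hterm a b] at key
    simp_rw [integral_finsetSum _ fun b _ ↦ hterm _ b, integral_const_mul,
      integral_mul_const] at key
    simpa only [dotProduct, mulVec, Matrix.of_apply, Pi.star_apply, Finset.mul_sum] using key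
  · obtain ⟨r, hr, h⟩ := hposdef m t fun i a ↦ Complex.exp (Complex.I * ω * t i) * x a
    have hr' : (0 : ℂ) ≤ r := by exact_mod_cast hr
    rw [← h] at hr'
    refine hr'.trans_eq (Finset.sum_congr rfl fun i _ ↦ Finset.sum_congr rfl fun j _ ↦
      Finset.sum_congr rfl fun a _ ↦ Finset.sum_congr rfl fun b _ ↦ ?_)
    have he : Complex.exp (Complex.I * ω * ((t j - t i : ℝ) : ℂ)) =
        starRingEnd ℂ (Complex.exp (Complex.I * ω * t i)) * Complex.exp (Complex.I * ω * t j) := by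
      rw [← Complex.exp_conj, ← Complex.exp_add]
      congr 1
      simp
      ring
    rw [he, map_mul, starRingEnd_apply (x a)]
    ring
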